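/- Let g : X → (0,1) be continuous with Σ_{a∈A} g(ax) = 1 for all x ∈ X, set φ = log g, and let μ be a probability measure on X with ∫ L_φ f dμ = ∫ f dμ for all continuous f. Then for every n ≥ 1, every a_1^n ∈ A^n and every x ∈ [a_1^n], e^{−n ε_n} ≤ μ(a_1^n) / exp(Σ_{k=1}^n φ(θ^{k−1}x)) ≤ e^{n ε_n}, where ε_n = (1/n) Σ_{k=1}^n var_k(φ). -/

import Mathlib

open MeasureTheory Filter Topology Set

namespace RTSpec

variable (A : Type*) [Fintype A] [TopologicalSpace A] [DiscreteTopology A]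
  [MeasurableSpace A] [BorelSpace A]

/-- The sequence space `X = A^ℕ` (0-indexed: `x 0` is the paper's `x₁`). -/
abbrev X := ℕ → A

/-- The shift map `θ`. -/
def shift : X A → X A := fun x n => x (n + 1)

/-- The cylinder `[a_1^n]` based on the word `w = a_1^n`. -/
def cyl {n : ℕ} (w : Fin n → A) : Set (X A) := {x | ∀ i : Fin n, x i.val = w i}

/-- Return time `R_n(x) = inf {k ≥ 2 : x_k^{k+n-1} = x_1^n}` (with `sInf ∅ = 0`). -/
noncomputable def retTime (n : ℕ) (x : X A) : ℕ := sInf {k | 2 ≤ k ∧ ∀ i < n, x (k - 1 + i) = x i}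

/-- Hitting time `T_{a_1^n}(y) = inf {k ≥ 1 : y_k^{k+n-1} = a_1^n}`. -/
noncomputable def hitTime {n : ℕ} (w : Fin n → A) (y : X A) : ℕ :=
  sInf {k | 1 ≤ k ∧ ∀ i : Fin n, y (k - 1 + i.val) = w i}

/-- Hitting/return time in the shifted sense: `inf {k ≥ 1 : θ^k y ∈ [a_1^n]}`. -/
noncomputable def hitTime' {n : ℕ} (w : Fin n → A) (y : X A) : ℕ :=
  sInf {k | 1 ≤ k ∧ ∀ i : Fin n, y (k + i.val) = w i}

/-- `τ(a_1^n) = inf {k ≥ 1 : [a_1^n] ∩ θ^{-k}[a_1^n] ≠ ∅}`, the smallest return time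
of the cylinder `[a_1^n]`. -/
noncomputable def tau {n : ℕ} (w : Fin n → A) : ℕ :=
  sInf {k | 1 ≤ k ∧ (cyl A w ∩ {y | ∀ i : Fin n, y (k + i.val) = w i}).Nonempty}

/-- `ζ_μ(a_1^n) = μ([a_1^n] ∩ {T_{a_1^n} ≠ τ(a_1^n)}) / μ([a_1^n])`. -/
noncomputable def zeta (μ : Measure (X A)) {n : ℕ} (w : Fin n → A) : ℝ :=
  (μ (cyl A w ∩ {y | hitTime' A w y ≠ tau A w})).toReal / (μ (cyl A w)).toReal

/-- A shift-invariant Borel probability measure. -/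
def InvProb (η : Measure (X A)) : Prop :=
  IsProbabilityMeasure η ∧ Measure.map (shift A) η = η

/-- The `n`-th term `-(1/n) Σ_{a_1^n} μ(a_1^n) log μ(a_1^n)` of the entropy sequence. -/
noncomputable def entSeq (μ : Measure (X A)) (n : ℕ) : ℝ :=
  -(1 / (n : ℝ)) * ∑ w : Fin n → A, (μ (cyl A w)).toReal * Real.log (μ (cyl A w)).toReal

/-- The entropy `h(μ)`, i.e. the limit of `entSeq` (which always exists for a
shift-invariant measure; we realize it as a liminf). -/
noncomputable def entropy (μ : Measure (X A)) : ℝ := atTop.liminf (entSeq A μ)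

/-- Topological pressure `P(ψ) = sup_η {h(η) + ∫ ψ dη}`, the supremum running over
all shift-invariant probability measures. -/
noncomputable def pressure (ψ : X A → ℝ) : ℝ :=
  sSup {r | ∃ η : Measure (X A), InvProb A η ∧ r = entropy A η + ∫ x, ψ x ∂η}

/-- `sup_η ∫ φ dη` over shift-invariant probability measures. -/
noncomputable def supInt (φ : X A → ℝ) : ℝ :=
  sSup {r | ∃ η : Measure (X A), InvProb A η ∧ r = ∫ x, φ x ∂η}

/-- `inf_η ∫ φ dη` over shift-invariant probability measures. -/
noncomputable def infInt (φ : X A → ℝ) : ℝ :=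
  sInf {r | ∃ η : Measure (X A), InvProb A η ∧ r = ∫ x, φ x ∂η}

/-- `var_n(φ) = sup {|φ(x) - φ(y)| : x_1^n = y_1^n}`. -/
noncomputable def Var (φ : X A → ℝ) (n : ℕ) : ℝ :=
  sSup {r | ∃ x y : X A, (∀ i < n, x i = y i) ∧ r = |φ x - φ y|}

/-- Prepending a symbol: `ax = (a, x_1, x_2, …)`. -/
def prepend (a : A) (x : X A) : X A := fun n => Nat.casesOn n a x

/-- A potential `φ` is normalized if `Σ_{a ∈ A} e^{φ(ax)} = 1` for all `x`. -/
def Normalized (φ : X A → ℝ) : Prop :=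
  ∀ x : X A, ∑ a : A, Real.exp (φ (prepend A a x)) = 1

/-- `μ` is an equilibrium state for `φ`: a probability measure fixed by the dual
transfer operator, i.e. `∫ L_φ f dμ = ∫ f dμ` for every continuous `f`. -/
def IsEqSt (φ : X A → ℝ) (μ : Measure (X A)) : Prop :=
  IsProbabilityMeasure μ ∧ ∀ f : X A → ℝ, Continuous f →
    ∫ x, (∑ a : A, Real.exp (φ (prepend A a x)) * f (prepend A a x)) ∂μ = ∫ x, f x ∂μ

/-- The `n`-th term `(1/n) log ∫ R_n^q dμ` of the return-time `L^q`-spectrum,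
with values in `EReal` (the integral may be infinite). -/
noncomputable def RSeq (μ : Measure (X A)) (q : ℝ) (n : ℕ) : EReal :=
  (((n : ℝ)⁻¹ : ℝ) : EReal) *
    ENNReal.log (∫⁻ x, ENNReal.ofReal ((retTime A n x : ℝ) ^ q) ∂μ)

/-- The `n`-th term `(1/n) log Σ_{a_1^n} μ(a_1^n)^{1-q}` of the `L^q`-spectrum of `μ`. -/
noncomputable def MSeq (μ : Measure (X A)) (q : ℝ) (n : ℕ) : ℝ :=
  (1 / (n : ℝ)) * Real.log (∑ w : Fin n → A, (μ (cyl A w)).toReal ^ (1 - q))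

/-- `Λ^{(n)}(μ) = (1/n) log Σ_{a_1^n} (1 - ζ_μ(a_1^n)) μ(a_1^n)`. -/
noncomputable def LamSeq (μ : Measure (X A)) (n : ℕ) : ℝ :=
  (1 / (n : ℝ)) * Real.log (∑ w : Fin n → A, (1 - zeta A μ w) * (μ (cyl A w)).toReal)

/-- `(1/n) log max_{a_1^n} μ(a_1^n)`. -/
noncomputable def gammaSeq (μ : Measure (X A)) (n : ℕ) : ℝ :=
  (1 / (n : ℝ)) * Real.log (⨆ w : Fin n → A, (μ (cyl A w)).toReal)

/-- `μ` is φ-mixing with rate `ϕ`: `ϕ` decreases to `0` and for all `n, ℓ ≥ 1`,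
all `S` in the σ-algebra generated by coordinates `1, …, n` with `μ S ≠ 0`, and
all `T` in the σ-algebra generated by coordinates `n+ℓ, n+ℓ+1, …`,
`|μ(S ∩ T)/μ(S) - μ(T)| ≤ ϕ(ℓ)`. -/
def PhiMixing (μ : Measure (X A)) (ϕ : ℕ → ℝ) : Prop :=
  (∀ ℓ, 0 < ϕ ℓ) ∧ Antitone ϕ ∧ Tendsto ϕ atTop (nhds 0) ∧
  ∀ n ℓ : ℕ, 1 ≤ n → 1 ≤ ℓ →
    ∀ S T : Set (X A),
      MeasurableSet[MeasurableSpace.comap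
        (fun x : X A => fun i : Fin n => x i.val) inferInstance] S →
      MeasurableSet[MeasurableSpace.comap
        (fun x : X A => fun j : ℕ => x (n + ℓ - 1 + j)) inferInstance] T →
      μ S ≠ 0 →
      |(μ (S ∩ T)).toReal / (μ S).toReal - (μ T).toReal| ≤ ϕ ℓ

omit [DiscreteTopology A] [MeasurableSpace A] [BorelSpace A] in
theorem bddAbove_var {φ : X A → ℝ} (hφ : Continuous φ) (n : ℕ) :
    BddAbove {r | ∃ x y : X A, (∀ i < n, x i = y i) ∧ r = |φ x - φ y|} := by
  obtain ⟨C, hC⟩ := isCompact_univ.exists_bound_of_continuousOn hφ.continuousOn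
  refine ⟨C + C, ?_⟩
  rintro r ⟨x, y, -, rfl⟩
  have hx := hC x (mem_univ x)
  have hy := hC y (mem_univ y)
  rw [Real.norm_eq_abs] at hx hy
  exact (abs_sub _ _).trans (add_le_add hx hy)

omit [DiscreteTopology A] [MeasurableSpace A] [BorelSpace A] in
theorem abs_sub_le_var {φ : X A → ℝ} (hφ : Continuous φ) {n : ℕ} {x y : X A}
    (h : ∀ i < n, x i = y i) : |φ x - φ y| ≤ Var A φ n :=
  le_csSup (bddAbove_var A hφ n) ⟨x, y, h, rfl⟩

omit [Fintype A] [MeasurableSpace A] [BorelSpace A] in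
theorem isClopen_cyl {n : ℕ} (w : Fin n → A) : IsClopen (cyl A w) := by
  have h : cyl A w = ⋂ i : Fin n, (fun x : X A => x i.val) ⁻¹' {w i} := by
    ext x
    simp [cyl]
  rw [h]
  exact isClopen_iInter_of_finite fun i => (isClopen_discrete {w i}).preimage (continuous_apply _)

omit [Fintype A] [DiscreteTopology A] [MeasurableSpace A] [BorelSpace A] in
theorem continuous_prepend (a : A) : Continuous (prepend A a) := by
  refine continuous_pi fun n => ?_
  cases n with
  | zero => exact continuous_const
  | succ k => exact continuous_apply k

omit [Fintype A] [TopologicalSpace A] [DiscreteTopology A] [MeasurableSpace A] [BorelSpace A] in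
theorem prepend_mem_cyl_iff {n : ℕ} (w : Fin (n + 1) → A) (a : A) (y : X A) :
    prepend A a y ∈ cyl A w ↔ a = w 0 ∧ y ∈ cyl A (Fin.tail w) := by
  simp only [cyl, mem_ofPred_eq, Fin.forall_fin_succ]
  rfl

omit [Fintype A] [TopologicalSpace A] [DiscreteTopology A] [MeasurableSpace A] [BorelSpace A] in
theorem shift_mem_cyl {n : ℕ} {w : Fin (n + 1) → A} {x : X A} (hx : x ∈ cyl A w) :
    shift A x ∈ cyl A (Fin.tail w) :=
  fun i => hx i.succ

/-- The dual transfer operator expresses the measure of a cylinder through that of its tail. -/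
theorem measureReal_cyl_succ {φ : X A → ℝ} {μ : Measure (X A)} (hμ : IsEqSt A φ μ) {n : ℕ}
    (w : Fin (n + 1) → A) :
    (μ (cyl A w)).toReal =
      ∫ y in cyl A (Fin.tail w), Real.exp (φ (prepend A (w 0) y)) ∂μ := by
  classical
  have hcont : Continuous ((cyl A w).indicator (fun _ => (1 : ℝ))) :=
    continuous_const.indicator fun x hx => by simp [(isClopen_cyl A w).frontier_eq] at hx
  have h := hμ.2 _ hcont
  rw [integral_indicator (isClopen_cyl A w).isOpen.measurableSet] at h
  simp only [integral_const, measureReal_restrict_apply_univ, smul_eq_mul, mul_one] at h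
  rw [← Measure.real, ← h, ← integral_indicator (isClopen_cyl A (Fin.tail w)).isOpen.measurableSet]
  congr 1
  ext y
  rw [Finset.sum_eq_single (w 0)]
  · by_cases hy : y ∈ cyl A (Fin.tail w) <;> simp [indicator, prepend_mem_cyl_iff, hy]
  · intro a _ ha
    simp [indicator, prepend_mem_cyl_iff, ha]
  · simp

theorem measureReal_cyl_mem_Icc {φ : X A → ℝ} (hφ : Continuous φ) {μ : Measure (X A)}
    (hμ : IsEqSt A φ μ) (n : ℕ) (w : Fin n → A) {x : X A} (hx : x ∈ cyl A w) :
    (μ (cyl A w)).toReal ∈ Icc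
      (Real.exp (∑ k ∈ Finset.range n, φ ((shift A)^[k] x) -
        ∑ k ∈ Finset.range n, Var A φ (k + 1)))
      (Real.exp (∑ k ∈ Finset.range n, φ ((shift A)^[k] x) +
        ∑ k ∈ Finset.range n, Var A φ (k + 1))) := by
  have := hμ.1
  induction n generalizing x with
  | zero =>
    have h : cyl A w = univ := by
      ext y
      simp [cyl]
    simp [h]
  | succ n ih =>
    obtain ⟨hl, hu⟩ := ih (Fin.tail w) (shift_mem_cyl A hx)
    have hmeas := (isClopen_cyl A (Fin.tail w)).isOpen.measurableSet
    have hvar : ∀ y ∈ cyl A (Fin.tail w),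
        |φ (prepend A (w 0) y) - φ x| ≤ Var A φ (n + 1) := fun y hy =>
      abs_sub_le_var A hφ fun i hi =>
        ((prepend_mem_cyl_iff A w (w 0) y).2 ⟨rfl, hy⟩ ⟨i, hi⟩).trans (hx ⟨i, hi⟩).symm
    have hint : IntegrableOn (fun y => Real.exp (φ (prepend A (w 0) y)))
        (cyl A (Fin.tail w)) μ :=
      (hφ.comp (continuous_prepend A (w 0))).rexp.continuousOn.integrableOn_compact
        (isClopen_cyl A (Fin.tail w)).isClosed.isCompact
    have hlow : (μ (cyl A (Fin.tail w))).toReal * Real.exp (φ x - Var A φ (n + 1)) ≤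
        (μ (cyl A w)).toReal := by
      have h := setIntegral_mono_on (μ := μ) (integrableOn_const
        (C := Real.exp (φ x - Var A φ (n + 1))) (measure_ne_top _ _)) hint hmeas
        fun y hy => Real.exp_le_exp.2 (by linarith [(abs_le.1 (hvar y hy)).1])
      rwa [setIntegral_const, smul_eq_mul, ← measureReal_cyl_succ A hμ w] at h
    have hup : (μ (cyl A w)).toReal ≤
        (μ (cyl A (Fin.tail w))).toReal * Real.exp (φ x + Var A φ (n + 1)) := by
      have h := setIntegral_mono_on (μ := μ) hint (integrableOn_const
        (C := Real.exp (φ x + Var A φ (n + 1))) (measure_ne_top _ _)) hmeas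
        fun y hy => Real.exp_le_exp.2 (by linarith [(abs_le.1 (hvar y hy)).2])
      rwa [setIntegral_const, smul_eq_mul, ← measureReal_cyl_succ A hμ w] at h
    rw [Finset.sum_range_succ' (fun k => φ ((shift A)^[k] x)),
      Finset.sum_range_succ (fun k => Var A φ (k + 1))]
    simp only [Function.iterate_succ_apply, Function.iterate_zero_apply]
    constructor
    · refine le_trans ?_ hlow
      rw [add_sub_add_comm, Real.exp_add]
      exact mul_le_mul_of_nonneg_right hl (Real.exp_pos _).le
    · refine hup.trans ?_
      rw [add_add_add_comm, Real.exp_add _ (φ x + _)]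
      exact mul_le_mul_of_nonneg_right hu (Real.exp_pos _).le

/-- for an equilibrium state `μ` of `φ = log g`, the measure of any
cylinder `[a_1^n]` is controlled by the Birkhoff sums of `φ` on the cylinder:
`e^{-n ε_n} ≤ μ(a_1^n)/exp(Σ_{k=1}^n φ(θ^{k-1}x)) ≤ e^{n ε_n}` for `x ∈ [a_1^n]`,
where `ε_n = (1/n) Σ_{k=1}^n var_k(φ)`. -/
theorem cylinder_measure_control
    (hcard : 1 < Fintype.card A)
    (g : X A → ℝ) (hgc : Continuous g) (hg01 : ∀ x, g x ∈ Set.Ioo (0 : ℝ) 1)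
    (hgsum : ∀ x : X A, ∑ a : A, g (prepend A a x) = 1)
    (μ : Measure (X A)) (hμ : IsEqSt A (fun x => Real.log (g x)) μ) :
    ∀ (n : ℕ), 1 ≤ n → ∀ w : Fin n → A, ∀ x ∈ cyl A w,
      Real.exp (-((n : ℝ) * ((1 / (n : ℝ)) *
          ∑ k ∈ Finset.range n, Var A (fun y => Real.log (g y)) (k + 1)))) ≤
        (μ (cyl A w)).toReal /
          Real.exp (∑ k ∈ Finset.range n, Real.log (g ((shift A)^[k] x))) ∧
      (μ (cyl A w)).toReal /
          Real.exp (∑ k ∈ Finset.range n, Real.log (g ((shift A)^[k] x))) ≤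
        Real.exp ((n : ℝ) * ((1 / (n : ℝ)) *
          ∑ k ∈ Finset.range n, Var A (fun y => Real.log (g y)) (k + 1))) := by
  intro n hn w x hx
  have hφ : Continuous fun y => Real.log (g y) := hgc.log fun y => (hg01 y).1.ne'
  obtain ⟨hl, hu⟩ := measureReal_cyl_mem_Icc A hφ hμ n w hx
  rw [← mul_assoc, mul_one_div_cancel (Nat.cast_ne_zero.2 (by omega)), one_mul,
    le_div_iff₀ (Real.exp_pos _), div_le_iff₀ (Real.exp_pos _), ← Real.exp_add, ← Real.exp_add,
    neg_add_eq_sub, add_comm (∑ k ∈ Finset.range n, Var A _ (k + 1))]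
  exact ⟨hl, hu⟩

end RTSpec
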